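/- Let k be a field, n, m ≥ 1, and consider the ideal J ⊆ k[x̃₀,…,x̃_{n−1}] generated by the polynomials g_s(x̃₀,…,x̃_{n−1}) = ∑_{i₁+⋯+i_m = s} x̃_{i₁}⋯x̃_{i_m} for s = 0,…,n−1 (indices ranging over {0,…,n−1}). Then the radical of J equals the prime ideal (x̃₀, x̃₁, …, x̃_{s−1}) where s = ⌈n/m⌉; in particular the scheme V(J) = ∇_{Z_n} Z_m is irreducible of dimension n − ⌈n/m⌉. -/

import Mathlib

open MvPolynomial

lemma aux_ker {k : Type*} [Field k] {σ : Type*} (S : Set σ) :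
    RingHom.ker (killCompl (R := k) (Subtype.val_injective (p := fun i => i ∉ S))) =
      Ideal.span (X '' S) := by
  apply le_antisymm
  · intro p hp
    have h : (Ideal.Quotient.mkₐ k (Ideal.span (X '' S : Set (MvPolynomial σ k)))) =
        ((Ideal.Quotient.mkₐ k (Ideal.span (X '' S))).comp (rename Subtype.val)).comp
          (killCompl (R := k) (Subtype.val_injective (p := fun i => i ∉ S))) := by
      apply algHom_ext
      intro i
      by_cases hi : i ∈ S
      · have h1 : killCompl (R := k) (Subtype.val_injective (p := fun i => i ∉ S)) (X i) = 0 := by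
          simp [killCompl, hi]
        rw [AlgHom.comp_apply, h1, map_zero]
        exact Ideal.Quotient.eq_zero_iff_mem.2 (Ideal.subset_span ⟨i, hi, rfl⟩)
      · have h1 : killCompl (R := k) (Subtype.val_injective (p := fun i => i ∉ S)) (X i) =
            X ⟨i, hi⟩ := by
          rw [← killCompl_rename_app (R := k) (Subtype.val_injective (p := fun i => i ∉ S))
            (X ⟨i, hi⟩), rename_X]
        rw [AlgHom.comp_apply, h1, AlgHom.comp_apply, rename_X]
    have h2 := AlgHom.congr_fun h p
    rw [AlgHom.comp_apply, (RingHom.mem_ker.1 hp : killCompl _ p = 0), map_zero] at h2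
    exact Ideal.Quotient.eq_zero_iff_mem.1 h2
  · rw [Ideal.span_le]
    rintro _ ⟨i, hi, rfl⟩
    simp [RingHom.mem_ker, killCompl, hi]

lemma aux_surj {k : Type*} [Field k] {σ : Type*} (S : Set σ) :
    Function.Surjective (killCompl (R := k) (Subtype.val_injective (p := fun i => i ∉ S))) :=
  fun p => ⟨_, killCompl_rename_app _ p⟩

lemma aux_prime {k : Type*} [Field k] {σ : Type*} (S : Set σ) :
    (Ideal.span (X '' S : Set (MvPolynomial σ k))).IsPrime := by
  rw [← aux_ker]
  exact RingHom.ker_isPrime _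

lemma aux_dim {k : Type*} [Field k] {σ : Type*} [Finite σ] (S : Set σ) :
    ringKrullDim (MvPolynomial σ k ⧸ Ideal.span (X '' S : Set (MvPolynomial σ k))) =
      (Nat.card {i // i ∉ S} : ℕ) := by
  rw [← aux_ker]
  refine (ringKrullDim_eq_of_ringEquiv (Ideal.quotientKerAlgEquivOfSurjective
    (aux_surj (k := k) S)).toRingEquiv).trans ?_
  rw [MvPolynomial.ringKrullDim_of_isNoetherianRing, ringKrullDim_eq_zero_of_field]
  simp

theorem stmt12 {k : Type*} [Field k] {n m : ℕ} (hn : 1 ≤ n) (hm : 1 ≤ m)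
    (J : Ideal (MvPolynomial (Fin n) k))
    (hJ : J = Ideal.span (Set.range fun s : Fin n =>
      ∑ t ∈ Finset.univ.filter (fun t : Fin m → Fin n => ∑ i, (t i : ℕ) = (s : ℕ)),
        ∏ i, (X (t i) : MvPolynomial (Fin n) k))) :
    J.radical = Ideal.span (X '' {i : Fin n | (i : ℕ) < (n + m - 1) / m}) ∧
      ringKrullDim (MvPolynomial (Fin n) k ⧸ J) = ((n - (n + m - 1) / m : ℕ) : ℕ) := by
  have key : ∀ i : ℕ, i < (n + m - 1) / m ↔ i * m < n := by
    intro i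
    rw [← Nat.succ_le_iff, Nat.le_div_iff_mul_le hm, Nat.succ_mul]
    omega
  have hrad : J.radical = Ideal.span (X '' {i : Fin n | (i : ℕ) < (n + m - 1) / m}) := by
    apply le_antisymm
    · rw [(aux_prime _).isRadical.radical_le_iff, hJ, Ideal.span_le]
      rintro _ ⟨s, rfl⟩
      refine Ideal.sum_mem _ fun t ht => ?_
      have ht := (Finset.mem_filter.1 ht).2
      obtain ⟨j, hj⟩ : ∃ j, (t j : ℕ) < (n + m - 1) / m := by
        by_contra! hc
        have h1 : ∑ i : Fin m, (n + m - 1) / m ≤ ∑ i, (t i : ℕ) :=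
          Finset.sum_le_sum fun i _ => hc i
        simp only [Finset.sum_const, Finset.card_univ, Fintype.card_fin, smul_eq_mul] at h1
        have h2 := (key ((n + m - 1) / m)).not.1 (lt_irrefl _)
        rw [mul_comm] at h2
        have := s.2
        omega
      exact Ideal.mem_of_dvd _ (Finset.dvd_prod_of_mem _ (Finset.mem_univ j))
        (Ideal.subset_span ⟨t j, hj, rfl⟩)
    · rw [Ideal.span_le]
      have main : ∀ a : ℕ, ∀ i : Fin n, (i : ℕ) = a → a * m < n →
          (X i : MvPolynomial (Fin n) k) ∈ J.radical := by
        intro a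
        induction a using Nat.strong_induction_on with
        | _ a ih =>
        intro i hia ha
        have hg : (∑ t ∈ Finset.univ.filter (fun t : Fin m → Fin n => ∑ i, (t i : ℕ) = a * m),
            ∏ i, (X (t i) : MvPolynomial (Fin n) k)) ∈ J.radical := by
          apply Ideal.le_radical
          rw [hJ]
          exact Ideal.subset_span ⟨⟨a * m, ha⟩, rfl⟩
        have hmem : (fun _ => i) ∈ Finset.univ.filter
            (fun t : Fin m → Fin n => ∑ i, (t i : ℕ) = a * m) := by
          simp [hia, mul_comm]
        rw [← Finset.add_sum_erase _ _ hmem] at hg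
        have hrest : (∑ t ∈ (Finset.univ.filter
            (fun t : Fin m → Fin n => ∑ i, (t i : ℕ) = a * m)).erase (fun _ => i),
            ∏ i, (X (t i) : MvPolynomial (Fin n) k)) ∈ J.radical := by
          refine Ideal.sum_mem _ fun t ht => ?_
          obtain ⟨hne, ht⟩ := Finset.mem_erase.1 ht
          have ht := (Finset.mem_filter.1 ht).2
          obtain ⟨j, hj⟩ : ∃ j, (t j : ℕ) < a := by
            by_contra! hc
            apply hne
            have h1 : ∑ _i : Fin m, a = ∑ i, (t i : ℕ) := by simp [ht, mul_comm]
            have h2 := (Finset.sum_eq_sum_iff_of_le fun i _ => hc i).1 h1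
            funext j
            exact Fin.ext (by rw [← h2 j (Finset.mem_univ j), hia])
          exact Ideal.mem_of_dvd _ (Finset.dvd_prod_of_mem _ (Finset.mem_univ j))
            (ih _ hj (t j) rfl (lt_of_le_of_lt (Nat.mul_le_mul_right _ hj.le) ha))
        have hp := (Ideal.add_mem_iff_left _ hrest).1 hg
        simp only [Finset.prod_const, Finset.card_univ, Fintype.card_fin] at hp
        exact J.radical_isRadical ⟨m, hp⟩
      rintro _ ⟨i, hi, rfl⟩
      exact main _ i rfl ((key _).1 hi)
  refine ⟨hrad, ?_⟩
  rw [ringKrullDim_quotient, ← PrimeSpectrum.zeroLocus_radical, ← ringKrullDim_quotient, hrad,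
    aux_dim]
  congr 2
  have hle : (n + m - 1) / m ≤ n := by
    by_contra! hc
    have := (key n).1 hc
    nlinarith
  rw [Nat.card_eq_fintype_card]
  simp only [Set.mem_ofPred_eq]
  rw [Fintype.card_subtype_compl]
  simp [Fintype.card_subtype, Fin.card_filter_val_lt, hle]
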